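/- arXiv:1606.04816 — 2 statements merged into one kernel-verified Lean document; each statement's English description precedes it below -/
import Mathlib

section
/- Let K > 2, let c = c'/2 where c' = |{k ∈ ℕ : T(K,k) is odd}|, let ≻₀ ∈ P, and let π ∈ P^n be a preference profile that exhibits consensus of level K!/2 − c around ≻₀. Then for all distinct ≻₁, ≻₂ ∈ P, if d(≻₁, ≻₀) ≤ d(≻₂, ≻₀) then μ_π(≻₁) ≥ μ_π(≻₂). -/
open Finset

/-- Preference relations on `K` alternatives, encoded as rankings, i.e. permutations
`σ` of `Fin K`: alternative `a` is preferred to `b` (`a ≻ b`) iff `σ a > σ b`.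
These are in natural bijection with the `K!` linear orders on a `K`-element set. -/
abbrev Pref (K : ℕ) := Equiv.Perm (Fin K)

/-- The inversion metric `d(≻,≻') = |≻ \ ≻'|`: the number of (unordered) pairs of
alternatives on which the two linear orders disagree. -/
def invDist {K : ℕ} (σ τ : Pref K) : ℕ :=
  (Finset.univ.filter fun p : Fin K × Fin K =>
    p.1 < p.2 ∧ ((σ p.1 < σ p.2) ↔ ¬ (τ p.1 < τ p.2))).card

/-- The reverse `⊽≻₀` of a preference relation `≻₀`: `a ⊽≻₀ b` iff `b ≻₀ a`. -/
def revPref {K : ℕ} (σ : Pref K) : Pref K := σ.trans Fin.revPerm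

/-- The Mahonian number `T(K,k)`: the number of permutations of `{1,…,K}` with
exactly `k` inversions. -/
def mahonian (K k : ℕ) : ℕ :=
  (Finset.univ.filter fun σ : Pref K => invDist σ (Equiv.refl (Fin K)) = k).card

/-- `c' = |{k ∈ ℕ : T(K,k) is odd}|`. -/
noncomputable def oddMahonianCount (K : ℕ) : ℕ := {k : ℕ | Odd (mahonian K k)}.ncard

/-- `P_k(≻₀) = {≻ ∈ P : d(≻,≻₀) = k}`. -/
def distSphere {K : ℕ} (σ₀ : Pref K) (k : ℕ) : Finset (Pref K) :=
  Finset.univ.filter fun σ => invDist σ σ₀ = k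

/-- `C ≥_{≻₀} C'` : `C` is at least as close to `≻₀` as `C'`. -/
def AtLeastAsClose {K : ℕ} (σ₀ : Pref K) (C C' : Finset (Pref K)) : Prop :=
  ∃ φ : Pref K → Pref K, Set.InjOn φ ↑C ∧ (∀ σ ∈ C, φ σ ∈ C') ∧
    ∀ σ ∈ C, invDist σ σ₀ ≤ invDist (φ σ) σ₀

/-- `C >_{≻₀} C'` : `C` is closer than `C'` to `≻₀`. -/
def Closer {K : ℕ} (σ₀ : Pref K) (C C' : Finset (Pref K)) : Prop :=
  ∃ φ : Pref K → Pref K, Set.InjOn φ ↑C ∧ (∀ σ ∈ C, φ σ ∈ C') ∧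
    (∀ σ ∈ C, invDist σ σ₀ ≤ invDist (φ σ) σ₀) ∧
    ∃ σ ∈ C, invDist σ σ₀ < invDist (φ σ) σ₀

/-- `μ_π(≻) = |{i : ≻ᵢ = ≻}|`. -/
def muRel {K n : ℕ} (π : Fin n → Pref K) (σ : Pref K) : ℕ :=
  (Finset.univ.filter fun i => π i = σ).card

/-- `μ_π(C) = |{i : ≻ᵢ ∈ C}|`. -/
def muSet {K n : ℕ} (π : Fin n → Pref K) (C : Finset (Pref K)) : ℕ :=
  (Finset.univ.filter fun i => π i ∈ C).card

/-- The profile `π` exhibits consensus of level `r` around `≻₀`. -/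
def ConsensusLevel {K n : ℕ} (π : Fin n → Pref K) (r : ℕ) (σ₀ : Pref K) : Prop :=
  (∀ C C' : Finset (Pref K), Disjoint C C' → C.card = r → C'.card = r →
      AtLeastAsClose σ₀ C C' → muSet π C' ≤ muSet π C) ∧
  (∃ C C' : Finset (Pref K), Disjoint C C' ∧ C.card = r ∧ C'.card = r ∧
      Closer σ₀ C C' ∧ muSet π C' < muSet π C)

/-- `(C₁, C₂)` is an `m`-balanced pair around `≻₀`. -/
def BalancedPair {K : ℕ} (σ₀ : Pref K) (m : ℕ) (C₁ C₂ : Finset (Pref K)) : Prop :=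
  Disjoint C₁ C₂ ∧ C₁.card = m ∧ C₂.card = m ∧
    ∀ k ≤ K * (K - 1) / 2,
      (C₁.filter fun σ => invDist σ σ₀ = k).card =
      (C₂.filter fun σ => invDist σ σ₀ = k).card

/-- The largest number of disjoint pairs in `S` whose two members lie on a common level of `d`. -/
def levelPairs {α : Type*} [Fintype α]
    (d : α → ℕ) (S : Finset α) : ℕ :=
  ∑ k ∈ univ.image d, (S.filter fun a => d a = k).card / 2

theorem card_filter_erase_level {α : Type*} [DecidableEq α]
    (d : α → ℕ) {S : Finset α} {x : α} (hx : x ∈ S) (k : ℕ) :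
    (S.filter fun a => d a = k).card =
      ((S.erase x).filter fun a => d a = k).card + if d x = k then 1 else 0 := by
  rw [filter_erase]
  split_ifs with hk
  · rw [card_erase_add_one (by simp [hx, hk])]
  · rw [erase_eq_of_notMem (by simp [hk]), add_zero]

theorem levelPairs_erase_erase {α : Type*} [Fintype α] [DecidableEq α]
    (d : α → ℕ) {S : Finset α} {x y : α} (hx : x ∈ S) (hy : y ∈ S)
    (hxy : x ≠ y) (hd : d x = d y) :
    levelPairs d S = levelPairs d ((S.erase x).erase y) + 1 := by
  have key : ∀ k, (S.filter fun a => d a = k).card / 2 =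
      (((S.erase x).erase y).filter fun a => d a = k).card / 2 + if d x = k then 1 else 0 := by
    intro k
    have h₁ := card_filter_erase_level d hx k
    have h₂ := card_filter_erase_level d (S := S.erase x) (x := y) (by simp [hy, hxy.symm]) k
    rw [← hd] at h₂
    split_ifs at * <;> omega
  simp only [levelPairs, key, sum_add_distrib, sum_ite_eq]
  simp

theorem levelPairs_le_erase_add_one {α : Type*} [Fintype α] [DecidableEq α]
    (d : α → ℕ) {S : Finset α} {x : α} (hx : x ∈ S) :
    levelPairs d S ≤ levelPairs d (S.erase x) + 1 := by
  have key : ∀ k, (S.filter fun a => d a = k).card / 2 ≤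
      ((S.erase x).filter fun a => d a = k).card / 2 + if d x = k then 1 else 0 := by
    intro k
    have h₁ := card_filter_erase_level d hx k
    split_ifs at * <;> omega
  calc levelPairs d S ≤ _ := sum_le_sum fun k _ => key k
    _ = levelPairs d (S.erase x) + 1 := by
      simp only [levelPairs, sum_add_distrib, sum_ite_eq]
      simp

theorem levelPairs_erase_of_odd {α : Type*} [Fintype α] [DecidableEq α]
    (d : α → ℕ) {S : Finset α} {x : α} (hx : x ∈ S)
    (ho : Odd (S.filter fun a => d a = d x).card) :
    levelPairs d (S.erase x) = levelPairs d S := by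
  refine sum_congr rfl fun k _ => ?_
  have h₁ := card_filter_erase_level d hx k
  rw [Nat.odd_iff] at ho
  split_ifs at h₁ with hk
  · subst hk
    omega
  · omega

theorem card_eq_two_mul_levelPairs_add {α : Type*} [Fintype α]
    (d : α → ℕ) :
    Fintype.card α = 2 * levelPairs d univ +
      {k : ℕ | Odd (univ.filter fun a => d a = k).card}.ncard := by
  have hset : {k : ℕ | Odd (univ.filter fun a => d a = k).card} =
      ↑((univ.image d).filter fun k => Odd (univ.filter fun a => d a = k).card) := by
    ext k
    simp only [Set.mem_ofPred_eq, coe_filter, mem_image, mem_univ, true_and, iff_and_self]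
    intro hk
    obtain ⟨a, ha⟩ := card_pos.mp hk.pos
    exact ⟨a, by simpa using ha⟩
  rw [hset, Set.ncard_coe_finset, card_filter, levelPairs, mul_sum, ← sum_add_distrib, ← card_univ,
    card_eq_sum_card_image d univ]
  refine sum_congr rfl fun k _ => ?_
  simp only [Nat.odd_iff]
  split_ifs <;> omega

/-- `D` and `D'` are disjoint subsets of `S` exchanged by a level-preserving permutation
that is supported in `S`. -/
def LevelMatched {α : Type*} [DecidableEq α]
    (d : α → ℕ) (S D D' : Finset α) : Prop :=
  D ⊆ S ∧ D' ⊆ S ∧ Disjoint D D' ∧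
    ∃ e : Equiv.Perm α, (∀ a, d (e a) = d a) ∧ (∀ a ∉ S, e a = a) ∧ D.image e = D'

theorem LevelMatched.symm {α : Type*} [DecidableEq α]
    {d : α → ℕ} {S D D' : Finset α} (h : LevelMatched d S D D') :
    LevelMatched d S D' D := by
  obtain ⟨hD, hD', hdis, e, hd, hS, rfl⟩ := h
  refine ⟨hD', hD, hdis.symm, e⁻¹, fun a => ?_, fun a ha => ?_, ?_⟩
  · simpa using (hd (e⁻¹ a)).symm
  · rw [Equiv.Perm.inv_eq_iff_eq, hS a ha]
  · ext a
    simp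

theorem exists_ne_of_levelPairs_pos {α : Type*} [Fintype α]
    {d : α → ℕ} {S : Finset α} (h : 0 < levelPairs d S) :
    ∃ x ∈ S, ∃ y ∈ S, x ≠ y ∧ d x = d y := by
  obtain ⟨k, -, hk⟩ := exists_ne_zero_of_sum_ne_zero h.ne'
  obtain ⟨x, hx, y, hy, hxy⟩ := one_lt_card.mp
    (show 1 < (S.filter fun a => d a = k).card by omega)
  rw [mem_filter] at hx hy
  exact ⟨x, hx.1, y, hy.1, hxy, hx.2.trans hy.2.symm⟩

theorem exists_levelMatched {α : Type*} [Fintype α] [DecidableEq α]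
    (d : α → ℕ) (m : ℕ) :
    ∀ S : Finset α, m ≤ levelPairs d S → ∃ D D', LevelMatched d S D D' ∧ D.card = m := by
  induction m with
  | zero => exact fun S _ => ⟨∅, ∅, ⟨by simp, by simp, by simp, 1, by simp⟩, rfl⟩
  | succ m ih =>
    intro S hS
    obtain ⟨x, hx, y, hy, hxy, hd⟩ := exists_ne_of_levelPairs_pos (by omega : 0 < levelPairs d S)
    have hp := levelPairs_erase_erase d hx hy hxy hd
    obtain ⟨D, D', ⟨hD, hD', hdis, e, hde, heS, rfl⟩, hm⟩ := ih ((S.erase x).erase y) (by omega)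
    have hsub : (S.erase x).erase y ⊆ S := (erase_subset _ _).trans (erase_subset _ _)
    have hxD : x ∉ D := fun h => by simpa using hD h
    have hyD : y ∉ D := fun h => by simpa using hD h
    have hxD' : x ∉ D.image e := fun h => by simpa using hD' h
    have hyD' : y ∉ D.image e := fun h => by simpa using hD' h
    have hex : e x = x := heS x (by simp)
    have hey : e y = y := heS y (by simp)
    refine ⟨insert x D, insert y (D.image e), ⟨?_, ?_, ?_, e * Equiv.swap x y, ?_, ?_, ?_⟩, ?_⟩
    · exact insert_subset hx (hD.trans hsub)
    · exact insert_subset hy (hD'.trans hsub)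
    · simp [disjoint_insert_left, disjoint_insert_right, hxy, hxy.symm, hyD, hdis] at *
      exact hxD'
    · intro a
      rw [Equiv.Perm.mul_apply, hde]
      rcases eq_or_ne a x with rfl | hax
      · simp [hd]
      rcases eq_or_ne a y with rfl | hay
      · simp [hd]
      rw [Equiv.swap_apply_of_ne_of_ne hax hay]
    · intro a ha
      rw [Equiv.Perm.mul_apply, Equiv.swap_apply_of_ne_of_ne (by rintro rfl; exact ha hx)
        (by rintro rfl; exact ha hy)]
      exact heS a fun h => ha (hsub h)
    · rw [image_insert]
      congr 1
      · simp [hey]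
      · refine image_congr fun a ha => ?_
        rw [Equiv.Perm.mul_apply, Equiv.swap_apply_of_ne_of_ne]
        · rintro rfl; exact hxD ha
        · rintro rfl; exact hyD ha
    · rw [card_insert_of_notMem hxD, hm]

/-- `f` gives at least as much weight to an `r`-set `C` as to a disjoint set obtained from `C`
by moving its members to levels of `d` that are at least as high. -/
def WeightAntitone {α : Type*} [DecidableEq α]
    (d f : α → ℕ) (r : ℕ) : Prop :=
  ∀ (C : Finset α) (e : Equiv.Perm α), Disjoint C (C.image e) → C.card = r →
    (∀ a ∈ C, d a ≤ d (e a)) → ∑ a ∈ C.image e, f a ≤ ∑ a ∈ C, f a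

theorem WeightAntitone.sum_add_sum_le {α : Type*} [DecidableEq α]
    {d f : α → ℕ} {r : ℕ} (H : WeightAntitone d f r)
    {S D D' X : Finset α} (hD : LevelMatched d S D D') (g : Equiv.Perm α)
    (hX : Disjoint X (X.image g)) (hXS : Disjoint X S) (hgS : ∀ a ∈ S, g a = a)
    (hg : ∀ a ∈ X, d a ≤ d (g a)) (hr : D.card + X.card = r) :
    ∑ a ∈ D', f a + ∑ a ∈ X.image g, f a ≤ ∑ a ∈ D, f a + ∑ a ∈ X, f a := by
  obtain ⟨hDS, hDS', hdis, e, hde, heS, rfl⟩ := hD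
  have hYS : Disjoint (X.image g) S := by
    rw [disjoint_left]
    intro b hb hbS
    obtain ⟨a, ha, rfl⟩ := mem_image.mp hb
    have : a = g a := (g.injective (hgS _ hbS)).symm
    exact disjoint_left.mp hXS ha (this ▸ hbS)
  have heX : ∀ a ∈ X, e a = a := fun a ha => heS a (disjoint_left.mp hXS ha)
  have hgD : ∀ a ∈ D, g (e a) = e a := fun a ha => hgS _ (hDS' (mem_image_of_mem e ha))
  have hDX : Disjoint D X := (hXS.mono_right hDS).symm
  have himg : (D ∪ X).image (g * e) = D.image e ∪ X.image g := by
    rw [image_union]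
    congr 1
    · exact image_congr fun a ha => hgD a ha
    · exact image_congr fun a ha => congrArg g (heX a ha)
  have := H (D ∪ X) (g * e) ?_ (by rw [card_union_of_disjoint hDX, hr]) ?_
  · rwa [himg, sum_union hDX, sum_union (hYS.mono_right hDS').symm] at this
  · rw [himg, disjoint_union_left, disjoint_union_right, disjoint_union_right]
    exact ⟨⟨hdis, (hYS.mono_right hDS).symm⟩, hXS.mono_right hDS', hX⟩
  · intro a ha
    rcases mem_union.mp ha with ha | ha
    · rw [Equiv.Perm.mul_apply, hgD a ha, hde]
    · rw [Equiv.Perm.mul_apply, heX a ha]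
      exact hg a ha

theorem WeightAntitone.sum_image_le {α : Type*} [Fintype α] [DecidableEq α]
    {d f : α → ℕ} {r : ℕ} (H : WeightAntitone d f r)
    {S X : Finset α} (g : Equiv.Perm α)
    (hX : Disjoint X (X.image g)) (hXS : Disjoint X S) (hgS : ∀ a ∈ S, g a = a)
    (hg : ∀ a ∈ X, d a ≤ d (g a)) (hXr : X.card ≤ r) (hr : r ≤ levelPairs d S + X.card) :
    ∑ a ∈ X.image g, f a ≤ ∑ a ∈ X, f a := by
  obtain ⟨D, D', hD, hm⟩ := exists_levelMatched d (r - X.card) S (by omega)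
  have hm' : D'.card = D.card := by
    obtain ⟨-, -, -, e, -, -, rfl⟩ := hD
    exact card_image_of_injective _ e.injective
  have h₁ := H.sum_add_sum_le hD g hX hXS hgS hg (by omega)
  have h₂ := H.sum_add_sum_le hD.symm g hX hXS hgS hg (by omega)
  omega

theorem WeightAntitone.le_of_levelPairs {α : Type*} [Fintype α] [DecidableEq α]
    {d f : α → ℕ} {r : ℕ} (H : WeightAntitone d f r)
    (hr : 0 < r) {x y : α} (hxy : x ≠ y) (hd : d x ≤ d y)
    (h : r ≤ levelPairs d ((univ.erase x).erase y) + 1) : f y ≤ f x := by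
  have := H.sum_image_le (S := (univ.erase x).erase y) (X := {x}) (Equiv.swap x y)
    (by simp [hxy]) (by simp) (fun a ha => ?_) (by simpa using hd) (by rw [card_singleton]; exact hr)
    (by simpa using h)
  · simpa using this
  · simp only [mem_erase] at ha
    exact Equiv.swap_apply_of_ne_of_ne ha.2.1 ha.1

theorem exists_ne_level_of_not_odd {α : Type*} [Fintype α]
    {d : α → ℕ} {x : α}
    (h : ¬ Odd (univ.filter fun a => d a = d x).card) : ∃ x', x' ≠ x ∧ d x' = d x := by
  have hpos : 0 < (univ.filter fun a => d a = d x).card := card_pos.mpr ⟨x, by simp⟩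
  rw [Nat.not_odd_iff] at h
  obtain ⟨x', hx', hne⟩ := exists_mem_ne
    (show 1 < (univ.filter fun a => d a = d x).card by omega) x
  exact ⟨x', hne, by simpa using hx'⟩

theorem WeightAntitone.antitone {α : Type*} [Fintype α] [DecidableEq α]
    {d f : α → ℕ} (H : WeightAntitone d f (levelPairs d univ))
    (hr : 0 < levelPairs d (univ : Finset α)) {x y : α} (hxy : x ≠ y) (hd : d x ≤ d y) :
    f y ≤ f x := by
  have same : ∀ {a b : α}, a ≠ b → d a = d b → f b ≤ f a := fun hab h =>
    H.le_of_levelPairs hr hab h.le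
      (levelPairs_erase_erase d (mem_univ _) (mem_univ _) hab h).le
  rcases hd.eq_or_lt with hd | hlt
  · exact same hxy hd
  by_cases hx : Odd (univ.filter fun a => d a = d x).card
  · refine H.le_of_levelPairs hr hxy hd ?_
    rw [← levelPairs_erase_of_odd d (mem_univ x) hx]
    exact levelPairs_le_erase_add_one d (by simp [hxy.symm])
  by_cases hy : Odd (univ.filter fun a => d a = d y).card
  · refine H.le_of_levelPairs hr hxy hd ?_
    rw [← levelPairs_erase_of_odd d (mem_univ y) hy, erase_right_comm]
    exact levelPairs_le_erase_add_one d (by simp [hxy])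
  obtain ⟨x', hx', hdx⟩ := exists_ne_level_of_not_odd hx
  obtain ⟨y', hy', hdy⟩ := exists_ne_level_of_not_odd hy
  have hxy' : x ≠ y' := by rintro rfl; omega
  have hx'y : x' ≠ y := by rintro rfl; omega
  have hx'y' : x' ≠ y' := by rintro rfl; omega
  have h₁ := levelPairs_erase_erase d (mem_univ x) (mem_univ x') hx'.symm hdx.symm
  have h₂ := levelPairs_erase_erase d (S := (univ.erase x).erase x') (x := y) (y := y')
    (by simp [hxy.symm, hx'y.symm]) (by simp [hxy'.symm, hx'y'.symm]) hy'.symm hdy.symm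
  have gx : (Equiv.swap x y * Equiv.swap x' y') x = y := by
    rw [Equiv.Perm.mul_apply, Equiv.swap_apply_of_ne_of_ne hx'.symm hxy', Equiv.swap_apply_left]
  have gx' : (Equiv.swap x y * Equiv.swap x' y') x' = y' := by
    rw [Equiv.Perm.mul_apply, Equiv.swap_apply_left, Equiv.swap_apply_of_ne_of_ne hxy'.symm hy']
  have himg : ({x, x'} : Finset α).image (Equiv.swap x y * Equiv.swap x' y') = {y, y'} := by
    rw [image_insert, image_singleton, gx, gx']
  have key := H.sum_image_le (S := (((univ.erase x).erase x').erase y).erase y') (X := {x, x'})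
    (Equiv.swap x y * Equiv.swap x' y') ?_ ?_ ?_ ?_ ?_ ?_
  · rw [himg, sum_pair hy'.symm, sum_pair hx'.symm] at key
    have := same hx'.symm hdx.symm
    have := same hy' hdy
    omega
  · rw [himg]
    simp [hxy.symm, hxy'.symm, hx'y.symm, hx'y'.symm]
  · simp
  · intro a ha
    simp only [mem_erase] at ha
    rw [Equiv.Perm.mul_apply, Equiv.swap_apply_of_ne_of_ne ha.2.2.1 ha.1,
      Equiv.swap_apply_of_ne_of_ne ha.2.2.2.1 ha.2.1]
  · intro a ha
    rcases mem_insert.mp ha with rfl | ha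
    · rw [gx]; exact hd
    · rw [mem_singleton.mp ha, gx']; omega
  · rw [card_pair hx'.symm]; omega
  · rw [card_pair hx'.symm]; omega

theorem two_mul_invDist {K : ℕ} (σ τ : Pref K) :
    2 * invDist σ τ = (univ.filter fun p : Fin K × Fin K =>
      p.1 ≠ p.2 ∧ ((σ p.1 < σ p.2) ↔ ¬ (τ p.1 < τ p.2))).card := by
  have hswap : invDist σ τ = (univ.filter fun p : Fin K × Fin K =>
      p.2 < p.1 ∧ ((σ p.1 < σ p.2) ↔ ¬ (τ p.1 < τ p.2))).card := by
    refine card_equiv (Equiv.prodComm _ _) fun p => ?_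
    simp only [mem_filter, mem_univ, true_and, Equiv.prodComm_apply, Prod.fst_swap, Prod.snd_swap]
    refine and_congr_right fun hp => ?_
    have hσ : σ p.1 ≠ σ p.2 := fun h => hp.ne (σ.injective h)
    have hτ : τ p.1 ≠ τ p.2 := fun h => hp.ne (τ.injective h)
    grind
  rw [two_mul]
  nth_rw 2 [hswap]
  rw [invDist, ← card_union_of_disjoint, ← filter_or]
  · congr 1
    ext p
    simp only [mem_filter, mem_univ, true_and, ← or_and_right, lt_or_lt_iff_ne]
  · rw [disjoint_filter]
    exact fun p _ h h' => lt_asymm h.1 h'.1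

/-- Relabelling the alternatives does not change the inversion metric. -/
theorem invDist_mul_right {K : ℕ} (σ τ ρ : Pref K) : invDist (σ * ρ) (τ * ρ) = invDist σ τ := by
  refine Nat.eq_of_mul_eq_mul_left two_pos ?_
  rw [two_mul_invDist, two_mul_invDist]
  exact card_equiv (ρ.prodCongr ρ) fun p => by simp

theorem mahonian_eq_card_distSphere {K : ℕ} (σ₀ : Pref K) (k : ℕ) :
    mahonian K k = (univ.filter fun σ : Pref K => invDist σ σ₀ = k).card := by
  refine card_equiv (Equiv.mulRight σ₀) fun σ => ?_
  have := invDist_mul_right σ 1 σ₀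
  rw [one_mul] at this
  simp [this, Equiv.Perm.one_def]

theorem factorial_half_sub_eq_levelPairs {K : ℕ} (σ₀ : Pref K) :
    K.factorial / 2 - oddMahonianCount K / 2 = levelPairs (fun σ => invDist σ σ₀) univ := by
  have h := card_eq_two_mul_levelPairs_add fun σ : Pref K => invDist σ σ₀
  rw [Fintype.card_perm, Fintype.card_fin] at h
  simp only [oddMahonianCount, mahonian_eq_card_distSphere σ₀]
  omega

theorem muSet_eq_sum_muRel {K n : ℕ} (π : Fin n → Pref K) (C : Finset (Pref K)) :
    muSet π C = ∑ σ ∈ C, muRel π σ := by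
  rw [muSet, card_eq_sum_card_fiberwise (f := π) (t := C) (by intro i; simp)]
  refine sum_congr rfl fun σ hσ => ?_
  rw [muRel, filter_filter]
  congr 1
  ext i
  simp only [mem_filter, mem_univ, true_and, and_iff_right_iff_imp]
  rintro rfl
  exact hσ

theorem ConsensusLevel.pos {K n r : ℕ} {π : Fin n → Pref K} {σ₀ : Pref K}
    (h : ConsensusLevel π r σ₀) : 0 < r := by
  obtain ⟨-, C, C', -, hC, -, ⟨φ, -, -, -, σ, hσ, -⟩, -⟩ := h
  exact hC ▸ card_pos.mpr ⟨σ, hσ⟩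

theorem ConsensusLevel.weightAntitone {K n r : ℕ} {π : Fin n → Pref K} {σ₀ : Pref K}
    (h : ConsensusLevel π r σ₀) : WeightAntitone (fun σ => invDist σ σ₀) (muRel π) r := by
  intro C e hdis hC he
  rw [← muSet_eq_sum_muRel, ← muSet_eq_sum_muRel]
  exact h.1 C _ hdis hC (by rw [card_image_of_injective _ e.injective, hC])
    ⟨e, e.injective.injOn, fun σ hσ => mem_image_of_mem e hσ, he⟩

/-- under level `K!/2 - c` consensus, closer orders occur at least
as often. -/
theorem stmt5 (K n : ℕ) (hK : 2 < K)
    (c : ℕ) (hc : c = oddMahonianCount K / 2)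
    (σ₀ : Pref K) (π : Fin n → Pref K)
    (h : ConsensusLevel π (K.factorial / 2 - c) σ₀) :
    ∀ σ₁ σ₂ : Pref K, σ₁ ≠ σ₂ →
      invDist σ₁ σ₀ ≤ invDist σ₂ σ₀ → muRel π σ₂ ≤ muRel π σ₁ := by
  subst hc
  rw [factorial_half_sub_eq_levelPairs σ₀] at h
  exact fun σ₁ σ₂ hne hd => h.weightAntitone.antitone h.pos hne hd
end

section
/- Let K > 2, let c = c'/2 where c' = |{k ∈ ℕ : T(K,k) is odd}|, let ≻₀ ∈ P, and let π ∈ P^n be a preference profile that exhibits consensus of level K!/2 − c around ≻₀. Then for all distinct ≻₁, ≻₂ ∈ P, if d(≻₁, ≻₀) = d(≻₂, ≻₀) then μ_π(≻₁) = μ_π(≻₂). -/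
open Finset

/-- The inversion distance counts the ordered pairs ranked in opposite ways. -/
lemma invDist_eq_card_opposite {K : ℕ} (σ τ : Pref K) :
    invDist σ τ = (univ.filter fun p : Fin K × Fin K =>
      σ p.1 < σ p.2 ∧ τ p.2 < τ p.1).card := by
  have trichotomy (ρ : Pref K) {a b : Fin K} (hab : a ≠ b) :
      ρ a < ρ b ∨ ρ b < ρ a := lt_or_gt_of_ne (ρ.injective.ne hab)
  unfold invDist
  refine card_bij' (fun p _ => if σ p.1 < σ p.2 then p else p.swap)
    (fun p _ => if p.1 < p.2 then p else p.swap) ?_ ?_ ?_ ?_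
  · rintro ⟨a, b⟩ hp
    simp only [mem_filter, mem_univ, true_and] at hp ⊢
    have := trichotomy σ hp.1.ne
    have := trichotomy τ hp.1.ne
    split_ifs with h <;> simp only [Prod.swap] <;> grind
  · rintro ⟨a, b⟩ hp
    simp only [mem_filter, mem_univ, true_and] at hp ⊢
    have hab : a ≠ b := by rintro rfl; exact lt_irrefl _ hp.1
    split_ifs with h <;> simp only [Prod.swap] <;> grind
  · rintro ⟨a, b⟩ hp
    simp only [mem_filter, mem_univ, true_and] at hp ⊢
    split_ifs <;> simp_all [Prod.swap]
    grind
  · rintro ⟨a, b⟩ hp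
    simp only [mem_filter, mem_univ, true_and] at hp ⊢
    split_ifs <;> simp_all [Prod.swap]
    grind

/-- The inversion distance is invariant under relabelling the alternatives. -/
lemma invDist_symm_trans_refl {K : ℕ} (σ τ : Pref K) :
    invDist (τ.symm.trans σ) (Equiv.refl (Fin K)) = invDist σ τ := by
  rw [invDist_eq_card_opposite, invDist_eq_card_opposite]
  refine card_equiv (τ.symm.prodCongr τ.symm) fun p => ?_
  rw [mem_filter, mem_filter]
  simp

lemma card_distSphere {K : ℕ} (σ₀ : Pref K) (k : ℕ) :
    (distSphere σ₀ k).card = mahonian K k := by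
  refine card_bij' (fun σ _ => σ₀.symm.trans σ) (fun σ _ => σ₀.trans σ) ?_ ?_ ?_ ?_
  · simp [distSphere, invDist_symm_trans_refl]
  · intro σ hσ
    rw [mem_filter] at hσ
    rw [distSphere, mem_filter, ← invDist_symm_trans_refl]
    simpa [← Equiv.trans_assoc] using hσ
  · intro σ _
    simp [← Equiv.trans_assoc]
  · intro σ _
    simp [← Equiv.trans_assoc]

section Fibers

variable {α : Type*} (d : α → ℕ)

/-- `C` and `C'` have equally many elements over each value of `d`. -/
def FiberwiseEquinumerous (C C' : Finset α) : Prop :=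
  ∀ k, (C.filter fun x => d x = k).card = (C'.filter fun x => d x = k).card

variable {d}

lemma FiberwiseEquinumerous.symm {C C' : Finset α} (h : FiberwiseEquinumerous d C C') :
    FiberwiseEquinumerous d C' C := fun k => (h k).symm

variable [DecidableEq α]

lemma FiberwiseEquinumerous.card_eq {C C' : Finset α} (h : FiberwiseEquinumerous d C C') :
    C.card = C'.card := by
  rw [card_eq_sum_card_fiberwise (f := d) (t := (C ∪ C').image d),
    card_eq_sum_card_fiberwise (s := C') (f := d) (t := (C ∪ C').image d)]
  · exact sum_congr rfl fun k _ => h k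
  · intro x hx
    simp only [mem_coe] at hx ⊢
    exact mem_image_of_mem d (mem_union_right _ hx)
  · intro x hx
    simp only [mem_coe] at hx ⊢
    exact mem_image_of_mem d (mem_union_left _ hx)

lemma FiberwiseEquinumerous.insert {C C' : Finset α} {a b : α}
    (h : FiberwiseEquinumerous d C C') (ha : a ∉ C) (hb : b ∉ C') (hd : d a = d b) :
    FiberwiseEquinumerous d (insert a C) (insert b C') := by
  intro k
  simp only [filter_insert, hd]
  split_ifs
  · rw [card_insert_of_notMem (by simp [ha]), card_insert_of_notMem (by simp [hb]), h k]
  · exact h k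

lemma FiberwiseEquinumerous.exists_injOn {C C' : Finset α}
    (h : FiberwiseEquinumerous d C C') :
    ∃ φ : α → α, Set.InjOn φ ↑C ∧ ∀ x ∈ C, φ x ∈ C' ∧ d (φ x) = d x := by
  let e := fun k => equivOfCardEq (h k)
  have mem (x : α) (hx : x ∈ C) : x ∈ C.filter fun y => d y = d x := by simp [hx]
  let φ : α → α := fun x => if hx : x ∈ C then e (d x) ⟨x, mem x hx⟩ else x
  have hφ (x : α) (hx : x ∈ C) : φ x ∈ C' ∧ d (φ x) = d x := by
    have := (e (d x) ⟨x, mem x hx⟩).2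
    rw [mem_filter] at this
    simpa [φ, hx] using this
  refine ⟨φ, ?_, hφ⟩
  intro x hx y hy hxy
  rw [mem_coe] at hx hy
  have hd : d x = d y := by rw [← (hφ x hx).2, ← (hφ y hy).2, hxy]
  have key : ∀ k (hxk : x ∈ C.filter fun z => d z = k) (hyk : y ∈ C.filter fun z => d z = k),
      (e k ⟨x, hxk⟩ : α) = e k ⟨y, hyk⟩ → x = y := by
    intro k hxk hyk hk
    simpa using (e k).injective (Subtype.ext hk)
  refine key (d y) (by simp [hx, hd]) (mem y hy) ?_
  have : ∀ k (hk : d x = k), φ x = e k ⟨x, by simp [hx, hk]⟩ := by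
    rintro _ rfl
    simp [φ, hx]
  rw [← this _ hd, hxy]
  simp [φ, hy]

/-- Removing two elements of one fiber preserves the parity of every fiber. -/
lemma odd_card_fiber_erase_erase {U : Finset α} {a b : α} (ha : a ∈ U) (hb : b ∈ U)
    (hab : a ≠ b) (hd : d a = d b) (k : ℕ) :
    Odd (((U.erase a).erase b).filter fun x => d x = k).card ↔
      Odd (U.filter fun x => d x = k).card := by
  have hb' : b ∈ U.erase a := mem_erase.2 ⟨hab.symm, hb⟩
  conv_rhs => rw [← insert_erase ha, ← insert_erase hb']
  simp only [filter_insert, hd]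
  split_ifs
  · rw [card_insert_of_notMem (by simp [hab]), card_insert_of_notMem (by simp)]
    simp [Nat.odd_add_one]
  · rfl

/-- A finite set contains two disjoint fiberwise equinumerous subsets that together
leave out just one element of each fiber of odd cardinality. -/
lemma exists_fiberwiseEquinumerous (d : α → ℕ) (U : Finset α) :
    ∃ C C' : Finset α, C ⊆ U ∧ C' ⊆ U ∧ Disjoint C C' ∧ FiberwiseEquinumerous d C C' ∧
      2 * C.card + {k | Odd (U.filter fun x => d x = k).card}.ncard = U.card := by
  induction U using Finset.strongInduction with
  | H U ih =>
    by_cases hinj : Set.InjOn d U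
    · refine ⟨∅, ∅, by simp, by simp, by simp, fun _ => rfl, ?_⟩
      have : {k | Odd (U.filter fun x => d x = k).card} = ↑(U.image d) := by
        ext k
        have hle : (U.filter fun x => d x = k).card ≤ 1 := by
          rw [card_le_one]
          intro x hx y hy
          rw [mem_filter] at hx hy
          exact hinj hx.1 hy.1 (hx.2.trans hy.2.symm)
        rw [Set.mem_ofPred_eq, mem_coe, mem_image]
        constructor
        · intro ho
          obtain ⟨x, hx⟩ := card_pos.1 ho.pos
          exact ⟨x, mem_filter.1 hx⟩
        · rintro ⟨x, hx⟩
          have hpos := card_pos.2 (⟨x, mem_filter.2 hx⟩ : (U.filter fun x => d x = k).Nonempty)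
          rw [le_antisymm hle hpos]
          exact odd_one
      rw [this, Set.ncard_coe_finset, card_image_of_injOn hinj]
      simp
    · obtain ⟨a, ha, b, hb, hd, hab⟩ :
          ∃ a ∈ U, ∃ b ∈ U, d a = d b ∧ a ≠ b := by
        simpa [Set.InjOn] using hinj
      have hb' : b ∈ U.erase a := mem_erase.2 ⟨Ne.symm hab, hb⟩
      obtain ⟨C, C', hC, hC', hdisj, hfib, hcard⟩ := ih ((U.erase a).erase b)
        ((erase_subset _ _).trans_ssubset (erase_ssubset ha))
      have haC : a ∉ C := fun h => by simpa using hC h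
      have hbC : b ∉ C := fun h => by simpa using hC h
      have haC' : a ∉ C' := fun h => by simpa using hC' h
      have hbC' : b ∉ C' := fun h => by simpa using hC' h
      have hsub : (U.erase a).erase b ⊆ U := (erase_subset _ _).trans (erase_subset _ _)
      refine ⟨insert a C, insert b C', insert_subset ha (hC.trans hsub),
        insert_subset hb (hC'.trans hsub), ?_, hfib.insert haC hbC' hd, ?_⟩
      · simp [haC', hbC, hdisj, Ne.symm hab]
      · simp only [odd_card_fiber_erase_erase ha hb hab hd] at hcard
        rw [card_insert_of_notMem haC, ← card_erase_add_one ha, ← card_erase_add_one hb']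
        omega

end Fibers

lemma FiberwiseEquinumerous.atLeastAsClose {K : ℕ} {σ₀ : Pref K} {C C' : Finset (Pref K)}
    (h : FiberwiseEquinumerous (fun σ => invDist σ σ₀) C C') : AtLeastAsClose σ₀ C C' := by
  obtain ⟨φ, hinj, hφ⟩ := h.exists_injOn
  exact ⟨φ, hinj, fun σ hσ => (hφ σ hσ).1, fun σ hσ => (hφ σ hσ).2.ge⟩

lemma muSet_insert {K n : ℕ} (π : Fin n → Pref K) {σ : Pref K} {C : Finset (Pref K)}
    (hσ : σ ∉ C) : muSet π (insert σ C) = muRel π σ + muSet π C := by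
  unfold muSet muRel
  rw [← card_union_of_disjoint]
  · congr 1
    ext i
    simp
  · rw [disjoint_filter]
    rintro i - rfl
    exact hσ

/-- Under a consensus, fiberwise equinumerous classes have the same frequency. -/
lemma ConsensusLevel.muSet_eq {K n r : ℕ} {π : Fin n → Pref K} {σ₀ : Pref K}
    (h : ConsensusLevel π r σ₀) {C C' : Finset (Pref K)} (hdisj : Disjoint C C')
    (hfib : FiberwiseEquinumerous (fun σ => invDist σ σ₀) C C') (hcard : C.card = r) :
    muSet π C = muSet π C' := by
  have hcard' : C'.card = r := hfib.card_eq.symm.trans hcard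
  exact le_antisymm (h.1 C' C hdisj.symm hcard' hcard hfib.symm.atLeastAsClose)
    (h.1 C C' hdisj hcard hcard' hfib.atLeastAsClose)

/-- under level `K!/2 - c` consensus, equidistant orders occur
equally often. -/
theorem stmt6 (K n : ℕ) (hK : 2 < K)
    (c : ℕ) (hc : c = oddMahonianCount K / 2)
    (σ₀ : Pref K) (π : Fin n → Pref K)
    (h : ConsensusLevel π (K.factorial / 2 - c) σ₀) :
    ∀ σ₁ σ₂ : Pref K, σ₁ ≠ σ₂ →
      invDist σ₁ σ₀ = invDist σ₂ σ₀ → muRel π σ₁ = muRel π σ₂ := by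
  intro σ₁ σ₂ hne hd
  obtain ⟨C, C', hC, hC', hdisj, hfib, hcard⟩ :=
    exists_fiberwiseEquinumerous (fun σ => invDist σ σ₀) ((univ.erase σ₁).erase σ₂)
  have h₁C : σ₁ ∉ C := fun h => by simpa using hC h
  have h₂C : σ₂ ∉ C := fun h => by simpa using hC h
  have h₁C' : σ₁ ∉ C' := fun h => by simpa using hC' h
  have h₂C' : σ₂ ∉ C' := fun h => by simpa using hC' h
  have hodd : {k | Odd (((univ.erase σ₁).erase σ₂).filter
      fun σ => invDist σ σ₀ = k).card}.ncard = oddMahonianCount K := by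
    simp only [odd_card_fiber_erase_erase (d := fun σ => invDist σ σ₀) (mem_univ σ₁) (mem_univ σ₂) hne hd]
    simp only [oddMahonianCount, ← card_distSphere σ₀, distSphere]
  have hK' : ((univ.erase σ₁).erase σ₂).card + 1 + 1 = K.factorial := by
    rw [card_erase_add_one (by simp [hne.symm]), card_erase_add_one (mem_univ _), card_univ,
      Fintype.card_perm, Fintype.card_fin]
  have hr : C.card + 1 = K.factorial / 2 - c := by omega
  have e₁ := h.muSet_eq (C := insert σ₁ C) (C' := insert σ₂ C')
    (by simp [hne.symm, h₁C', h₂C, hdisj]) (hfib.insert h₁C h₂C' hd)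
    (by rw [card_insert_of_notMem h₁C, hr])
  have e₂ := h.muSet_eq (C := insert σ₂ C) (C' := insert σ₁ C')
    (by simp [hne, h₂C', h₁C, hdisj]) (hfib.insert h₂C h₁C' hd.symm)
    (by rw [card_insert_of_notMem h₂C, hr])
  rw [muSet_insert π h₁C, muSet_insert π h₂C'] at e₁
  rw [muSet_insert π h₂C, muSet_insert π h₁C'] at e₂
  omega
end
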